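/- Assume e = N = 3, p ≡ 1 (mod 3), 3 | m (so 3 | ms), and 3 divides (q−1)/h. Write η₁ = η_1^{(3,r)}, η_α = η_α^{(3,r)}, η_{α²} = η_{α²}^{(3,r)}, and set T = (−1)^{ms}(π^{ms} + π̄^{ms}), A = (−1)^{ms}(u(α)² π^{ms} + u(α) π̄^{ms}), B = (−1)^{ms}(u(α) π^{ms} + u(α)² π̄^{ms}). Then the modified weight λ(a,b), as (a,b) ranges over GF(r)², takes only the values listed below, and for every real number x, the number of pairs (a,b) ∈ GF(r)² with λ(a,b) = x equals the sum of the following frequencies over those listed values that equal x: (3h/q)η₁, (3h/q)η_α, (3h/q)η_{α²} each with frequency (r−1)(r−8−T)/27; (h/q)(2η₁+η_α) with frequency (r−1)(r−2−A)/9; (h/q)(2η₁+η_{α²}) with frequency (r−1)(r−2−B)/9; (h/q)(2η_α+η₁) with frequency (r−1)(r−2−B)/9; (h/q)(2η_α+η_{α²}) with frequency (r−1)(r−2−A)/9; (h/q)(2η_{α²}+η₁) with frequency (r−1)(r−2−A)/9; (h/q)(2η_{α²}+η_α) with frequency (r−1)(r−2−B)/9; −h/q with frequency 2(r−1)(r+1−T)/9;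 (h/(3q))(r−1+6η₁), (h/(3q))(r−1+6η_α), (h/(3q))(r−1+6η_{α²}) each with frequency r−1; h(r−1)/q with frequency 1. -/

import Mathlib

open scoped Classical

/-- The Eisenstein integers `ℤ[ω]`, with `ω ^ 2 = -1 - ω`. -/
abbrev EisensteinInt : Type := QuadraticAlgebra ℤ (-1) (-1)

namespace EisensteinInt

open QuadraticAlgebra

theorem norm_eq (x : EisensteinInt) : x.norm = x.re ^ 2 - x.re * x.im + x.im ^ 2 := by
  rw [norm_def]; ring

theorem mul_star_eq (x : EisensteinInt) : x * star x = (x.norm : EisensteinInt) := by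
  rw [← algebraMap_norm_eq_mul_star]; rfl

theorem norm_eq_zero {x : EisensteinInt} (hx : x.norm = 0) : x = 0 := by
  rw [norm_eq] at hx
  have h1 : x.im = 0 := by
    have : x.im ^ 2 = 0 := by nlinarith [sq_nonneg (2 * x.re - x.im), sq_nonneg x.im]
    simpa using this
  have h2 : x.re = 0 := by rw [h1] at hx; simpa using hx
  ext <;> simp [h1, h2]

instance : NoZeroDivisors EisensteinInt where
  eq_zero_or_eq_zero_of_mul_eq_zero {a b} hab := by
    have h : a.norm * b.norm = 0 := by rw [← map_mul, hab, QuadraticAlgebra.norm_zero]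
    exact (mul_eq_zero.mp h).imp norm_eq_zero norm_eq_zero

instance : IsDomain EisensteinInt := NoZeroDivisors.to_isDomain _

theorem omega_sq : (omega : EisensteinInt) ^ 2 = -1 - omega := by
  ext <;> simp [pow_two]

theorem star_omega : star (omega : EisensteinInt) = -1 - omega := by
  ext <;> simp

theorem omega_pow_three : (omega : EisensteinInt) ^ 3 = 1 := by
  linear_combination (omega - 1 : EisensteinInt) * omega_sq

theorem eq_re_add_im (x : EisensteinInt) :
    x = (x.re : EisensteinInt) + x.im * (omega : EisensteinInt) := by
  ext <;> simp

theorem isPrimitiveRoot_omega : IsPrimitiveRoot (omega : EisensteinInt) 3 := by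
  refine IsPrimitiveRoot.iff_orderOf.mpr (orderOf_eq_prime omega_pow_three fun h => ?_)
  simpa using congrArg QuadraticAlgebra.im h

theorem map_eq {F : Type*} [Field F] (φ : EisensteinInt →+* F) (x : EisensteinInt) :
    φ x = (x.re : F) + x.im * φ omega := by
  conv_lhs => rw [eq_re_add_im x]
  simp

theorem natCast_dvd_of_map_eq_zero {F : Type*} [Field F] {p : ℕ} [Fact p.Prime] [CharP F p]
    (φ : EisensteinInt →+* F) (hp : p ≠ 3) {x : EisensteinInt} (hx : φ x = 0)
    (hx' : φ (star x) = 0) : (p : EisensteinInt) ∣ x := by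
  have h3 : (3 : F) ≠ 0 := by
    intro h
    have : (p : ℕ) ∣ 3 := (CharP.cast_eq_zero_iff F p 3).mp (by exact_mod_cast h)
    exact hp ((Nat.prime_dvd_prime_iff_eq Fact.out Nat.prime_three).mp this)
  have hw : φ omega ^ 2 = -1 - φ omega := by
    rw [← map_pow, omega_sq]; simp
  have hs : φ (star x) = (x.re : F) - x.im - x.im * φ omega := by
    rw [map_eq]; simp; ring
  rw [map_eq] at hx
  rw [hs] at hx'
  have him : (x.im : F) = 0 := by
    have : (x.im : F) * 3 = 0 := by
      linear_combination (2 * φ omega + 1) * (hx' - hx) + 4 * (x.im : F) * hw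
    simpa [h3] using this
  have hre : (x.re : F) = 0 := by simpa [him] using hx
  obtain ⟨c, hc⟩ := (CharP.intCast_eq_zero_iff F p _).mp hre
  obtain ⟨d, hd⟩ := (CharP.intCast_eq_zero_iff F p _).mp him
  refine ⟨⟨c, d⟩, ?_⟩
  ext <;> simp [hc, hd]

theorem dvd_of_map_eq_zero {F : Type*} [Field F] {p : ℕ} [Fact p.Prime] [CharP F p]
    (φ : EisensteinInt →+* F) (hp : p ≠ 3) {π x : EisensteinInt} (hπ : π.norm = p) (hπ0 : φ π = 0)
    (hx : φ x = 0) : π ∣ x := by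
  obtain ⟨y, hy⟩ := natCast_dvd_of_map_eq_zero (p := p) φ hp (x := x * star π) (by simp [hx])
    (by simp [hπ0])
  refine ⟨y, ?_⟩
  have hs : star π ≠ 0 := by
    intro h
    have : π = 0 := by simpa using h
    rw [this, QuadraticAlgebra.norm_zero] at hπ
    exact (Fact.out : p.Prime).ne_zero (by exact_mod_cast hπ.symm)
  apply mul_right_cancel₀ hs
  rw [hy]
  have := mul_star_eq π
  rw [hπ] at this
  push_cast at this
  rw [← this]; ring

theorem exists_eq_unit_mul_pow {F : Type*} [Field F] {p : ℕ} [Fact p.Prime] [CharP F p]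
    (φ : EisensteinInt →+* F) (hp : p ≠ 3) {π : EisensteinInt} (hπ : π.norm = p)
    (hπ0 : φ π = 0) (l : ℕ) : ∀ x : EisensteinInt, x.norm = p ^ l → φ (star x) ≠ 0 →
      ∃ u : EisensteinInt, u.norm = 1 ∧ x = u * π ^ l := by
  induction l with
  | zero => intro x hx _; exact ⟨x, by simpa using hx, by simp⟩
  | succ l ih =>
    intro x hx hx'
    have h0 : φ x * φ (star x) = 0 := by
      rw [← map_mul, mul_star_eq, hx]; simp
    obtain ⟨y, rfl⟩ := dvd_of_map_eq_zero (p := p) φ hp hπ hπ0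
      ((mul_eq_zero.mp h0).resolve_right hx')
    have hp0 : (p : ℤ) ≠ 0 := by exact_mod_cast (Fact.out : p.Prime).ne_zero
    obtain ⟨u, hu, rfl⟩ := ih y (by
      rw [map_mul, hπ, pow_succ'] at hx
      exact mul_left_cancel₀ hp0 hx) (by
      intro h; apply hx'; simp [h])
    exact ⟨u, hu, by ring⟩

theorem eq_of_norm_eq_one {u : EisensteinInt} {ε : ℤ} (hε : ε ^ 2 = 1) (hu : u.norm = 1)
    (h : (3 : EisensteinInt) ∣ u - ε) : u = ε := by
  obtain ⟨w, hw⟩ := h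
  have h1 : u.re = ε + 3 * w.re := by
    have := congrArg QuadraticAlgebra.re hw
    simp at this; linarith
  have h2 : u.im = 3 * w.im := by
    have := congrArg QuadraticAlgebra.im hw
    simpa using this
  rw [norm_eq] at hu
  have h3 : w.im = 0 := by
    have : u.im ^ 2 < 3 := by nlinarith [sq_nonneg (2 * u.re - u.im)]
    rw [h2] at this
    by_contra h
    have : 0 < w.im ^ 2 := by positivity
    nlinarith
  have h4 : u.im = 0 := by simp [h2, h3]
  rw [h4] at hu
  have h5 : u.re = ε := by
    rcases sq_eq_one_iff.mp hε with rfl | rfl <;>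
    rcases sq_eq_one_iff.mp (show u.re ^ 2 = 1 by linarith) with h | h <;> omega
  ext <;> simp [h4, h5]

/-- An Eisenstein integer of norm `p ^ l`, prime to the conjugate of a prime `π` of norm `p` and
congruent to `-1` modulo `3`, is `(-1) ^ (l + 1) * π ^ l` when `π` is congruent to `-1`. -/
theorem eq_neg_one_pow_mul_pow {F : Type*} [Field F] {p : ℕ} [Fact p.Prime] [CharP F p]
    (φ : EisensteinInt →+* F) (hp : p ≠ 3) {π x : EisensteinInt} (hπ : π.norm = p)
    (hπ0 : φ π = 0) (hπ3 : (3 : EisensteinInt) ∣ π + 1) {l : ℕ} (hx : x.norm = p ^ l)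
    (hx0 : φ (star x) ≠ 0) (hx3 : (3 : EisensteinInt) ∣ x + 1) :
    x = (-1) ^ (l + 1) * π ^ l := by
  obtain ⟨u, hu, rfl⟩ := exists_eq_unit_mul_pow (p := p) φ hp hπ hπ0 l x hx hx0
  have h1 : (3 : EisensteinInt) ∣ π ^ l - (-1) ^ l := by
    refine hπ3.trans ?_
    simpa using sub_dvd_pow_sub_pow π (-1) l
  have hsq : ((-1 : EisensteinInt) ^ l) * (-1) ^ l = 1 := by
    rw [← mul_pow]; simp
  have h2 : (3 : EisensteinInt) ∣ u - ((-1) ^ (l + 1) : ℤ) := by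
    have h3 : (3 : EisensteinInt) ∣ (-1) ^ l * (u * π ^ l + 1) - (-1) ^ l * u * (π ^ l - (-1) ^ l) :=
      dvd_sub (hx3.mul_left _) (h1.mul_left _)
    convert h3 using 1
    push_cast
    linear_combination (-u) * hsq
  rw [eq_of_norm_eq_one (by rw [← pow_mul, mul_comm, pow_mul]; simp) hu h2]
  push_cast
  ring

end EisensteinInt

theorem Nat.Prime.not_dvd_choose_two_mul {p c : ℕ} (hp : p.Prime) (hc : p = 3 * c + 1) (l : ℕ) :
    ∀ k : ℕ, p ^ l = 3 * k + 1 → ¬ p ∣ (2 * k).choose k := by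
  induction l with
  | zero =>
    intro k hk
    obtain rfl : k = 0 := by simpa using hk
    simpa using hp.one_lt.ne'
  | succ l ih =>
    intro k hk
    have : Fact p.Prime := ⟨hp⟩
    obtain ⟨j, hj⟩ : ∃ j, p ^ l = 3 * j + 1 := by
      have h1 : p ^ l % 3 = 1 := by
        rw [Nat.pow_mod, show p % 3 = 1 by omega]; simp
      exact ⟨p ^ l / 3, by omega⟩
    obtain rfl : k = p * j + c := by
      rw [pow_succ', hj] at hk; nlinarith
    have hp0 := hp.pos
    have e1 : 2 * (p * j + c) = 2 * c + p * (2 * j) := by ring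
    have e2 : p * j + c = c + p * j := by ring
    have hmod := Choose.choose_modEq_choose_mod_mul_choose_div_nat (n := 2 * (p * j + c))
      (k := p * j + c) (p := p)
    rw [(hmod.dvd_iff dvd_rfl), e1, e2, Nat.add_mul_mod_self_left, Nat.add_mul_mod_self_left,
      Nat.add_mul_div_left _ _ hp0, Nat.add_mul_div_left _ _ hp0,
      Nat.mod_eq_of_lt (by omega), Nat.mod_eq_of_lt (by omega), Nat.div_eq_of_lt (by omega),
      Nat.div_eq_of_lt (by omega), zero_add, zero_add, hp.dvd_mul]
    rintro (h | h)
    · have h' : p ∣ (2 * c).factorial := by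
        rw [← Nat.choose_mul_factorial_mul_factorial (show c ≤ 2 * c by omega), mul_assoc]
        exact h.mul_right _
      have := (hp.dvd_factorial).mp h'
      omega
    · exact ih j hj h

theorem FiniteField.sum_pow_mul_one_sub_pow_ne_zero {F : Type*} [Field F] [Fintype F] {p l k : ℕ}
    [Fact p.Prime] [CharP F p] (hp : p % 3 = 1) (hF : Fintype.card F = p ^ l)
    (hk : p ^ l = 3 * k + 1) (hk0 : k ≠ 0) :
    ∑ x : F, x ^ (2 * k) * (1 - x) ^ (2 * k) ≠ 0 := by
  have hsum : ∀ j ≤ 2 * k, ∑ x : F, x ^ (2 * k + j) = if j = k then -1 else 0 := by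
    intro j hj
    have h0 : ∑ x : F, x ^ (2 * k + j) = ∑ x : Fˣ, (x ^ (2 * k + j) : F) := by
      rw [Fintype.sum_eq_add_sum_compl 0, zero_pow (by omega), zero_add]
      symm
      refine Finset.sum_bij (fun x _ => (x : F)) (by simp) (fun a _ b _ h => Units.ext h) ?_ (by simp)
      intro b hb
      exact ⟨Units.mk0 b (by simpa using hb), by simp, by simp⟩
    rw [h0, FiniteField.sum_pow_units, hF, hk, Nat.add_sub_cancel]
    refine if_congr ⟨?_, ?_⟩ rfl rfl
    · rintro ⟨d, hd⟩
      have : d = 1 := by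
        rcases Nat.lt_or_ge d 2 with h | h
        · interval_cases d <;> omega
        · have := Nat.mul_le_mul_left (3 * k) h
          omega
      subst this; omega
    · rintro rfl; exact ⟨1, by omega⟩
  have : ∑ x : F, x ^ (2 * k) * (1 - x) ^ (2 * k) = -((-1) ^ k * ((2 * k).choose k : F)) := by
    calc _ = ∑ x : F, ∑ j ∈ Finset.range (2 * k + 1),
          ((-1) ^ j * ((2 * k).choose j : F)) * x ^ (2 * k + j) := by
          refine Finset.sum_congr rfl fun x _ => ?_
          rw [sub_eq_neg_add, add_pow, Finset.mul_sum]
          refine Finset.sum_congr rfl fun j _ => ?_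
          rw [neg_pow, pow_add]; ring
      _ = ∑ j ∈ Finset.range (2 * k + 1), ((-1) ^ j * ((2 * k).choose j : F)) *
            (if j = k then -1 else 0) := by
          rw [Finset.sum_comm]
          refine Finset.sum_congr rfl fun j hj => ?_
          rw [← Finset.mul_sum, hsum j (by simpa [Nat.lt_succ_iff] using hj)]
      _ = _ := by
          simp only [mul_ite, mul_zero, Finset.sum_ite_eq']
          rw [if_pos (by simp; omega)]
          ring
  rw [this, neg_ne_zero]
  refine mul_ne_zero (pow_ne_zero _ (by simp)) fun h => ?_
  exact Nat.Prime.not_dvd_choose_two_mul (c := p / 3) (Fact.out : p.Prime) (by omega) l k hk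
    ((CharP.cast_eq_zero_iff F p _).mp h)

namespace EisensteinInt

open QuadraticAlgebra

theorem injective_ringHom (ι : EisensteinInt →+* ℂ) : Function.Injective ι := by
  rw [injective_iff_map_eq_zero]
  intro x hx
  have h : ι (x * star x) = 0 := by simp [hx]
  rw [mul_star_eq, map_intCast] at h
  exact norm_eq_zero (by exact_mod_cast h)

theorem star_mulChar {F : Type*} [Field F] {χ : MulChar F EisensteinInt} (hχ : χ ^ 3 = 1) (x : F) :
    star (χ x) = χ x ^ 2 := by
  by_cases hx : x = 0
  · simp [hx, MulChar.map_zero]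
  have h3 : χ x ^ 3 = 1 := by
    rw [← MulChar.pow_apply' _ (by norm_num), hχ, MulChar.one_apply (isUnit_iff_ne_zero.mpr hx)]
  obtain ⟨i, hi, h⟩ := isPrimitiveRoot_omega.eq_pow_of_pow_eq_one h3
  rw [← h]
  have hw := omega_sq
  interval_cases i
  · simp
  · simp only [pow_one]; rw [star_omega, omega_sq]
  · rw [star_pow, star_omega]; linear_combination (-omega ^ 2 + omega + 1 : EisensteinInt) * hw

variable {F : Type*} [Field F] [Fintype F]

theorem star_jacobiSum {χ : MulChar F EisensteinInt} (hχ : χ ^ 3 = 1) :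
    star (jacobiSum χ χ) = jacobiSum χ⁻¹ χ⁻¹ := by
  have hinv : χ⁻¹ = χ ^ 2 := inv_eq_of_mul_eq_one_right (by rw [← hχ, pow_succ' χ 2])
  simp only [jacobiSum, star_sum, star_mul', star_mulChar hχ, hinv, MulChar.pow_apply' _ two_ne_zero]

theorem norm_jacobiSum {p : ℕ} [Fact p.Prime] [CharP F p] {χ : MulChar F EisensteinInt}
    (ι : EisensteinInt →+* ℂ) (hχ : χ ^ 3 = 1) (hχ1 : χ ≠ 1) :
    (jacobiSum χ χ).norm = Fintype.card F := by
  have hinj := injective_ringHom ι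
  have hne : χ.ringHomComp ι ≠ 1 := by
    rwa [Ne, MulChar.ringHomComp_eq_one_iff hinj]
  have hne2 : χ.ringHomComp ι * χ.ringHomComp ι ≠ 1 := by
    rw [← MulChar.ringHomComp_mul, Ne, MulChar.ringHomComp_eq_one_iff hinj]
    intro h
    apply hχ1
    rw [← hχ, pow_succ, pow_two, h, one_mul]
  have hchar : ringChar ℂ ≠ ringChar F := by
    rw [ringChar.eq_zero, ringChar.eq F p]
    exact (Fact.out : p.Prime).ne_zero.symm
  have h := jacobiSum_mul_jacobiSum_inv hchar hne hne hne2
  rw [MulChar.ringHomComp_inv, jacobiSum_ringHomComp, jacobiSum_ringHomComp, ← star_jacobiSum hχ,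
    ← map_mul, mul_star_eq, map_intCast] at h
  exact_mod_cast h

/-- Evaluation of the cubic Jacobi sum of a finite field of characteristic `p ≡ 1 (mod 3)`. -/
theorem jacobiSum_eq {p l k : ℕ} [Fact p.Prime] [CharP F p] (hp : p % 3 = 1)
    (hF : Fintype.card F = p ^ l) (hk : p ^ l = 3 * k + 1) {χ : MulChar F EisensteinInt}
    (ι : EisensteinInt →+* ℂ) (hχ : χ ^ 3 = 1) (hχ1 : χ ≠ 1) (φ : EisensteinInt →+* F)
    (hφ : ∀ x, φ (χ x) = x ^ k) {π : EisensteinInt} (hπ : π.norm = p) (hπ0 : φ π = 0)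
    (hπ3 : (3 : EisensteinInt) ∣ π + 1) :
    jacobiSum χ χ = (-1) ^ (l + 1) * π ^ l := by
  have hk0 : k ≠ 0 := by
    rintro rfl
    simpa [MulChar.map_zero] using hφ 0
  refine eq_neg_one_pow_mul_pow φ (p := p) (by omega) hπ hπ0 hπ3 ?_ ?_ ?_
  · rw [norm_jacobiSum (p := p) ι hχ hχ1, hF]; push_cast; rfl
  · convert FiniteField.sum_pow_mul_one_sub_pow_ne_zero (F := F) hp hF hk hk0 using 1
    simp only [jacobiSum, star_sum, star_mul', star_mulChar hχ, map_sum, map_mul, map_pow, hφ]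
    exact Finset.sum_congr rfl fun x _ => by ring
  · obtain ⟨z, -, hz⟩ := exists_jacobiSum_eq_neg_one_add (n := 3) (by norm_num) hχ hχ
      (by rw [hF, hk]; simp) isPrimitiveRoot_omega
    refine ⟨-z * omega, ?_⟩
    rw [hz]
    linear_combination z * omega_sq

end EisensteinInt

section CubicIndex

variable {F : Type*} [Field F] {α : Fˣ}

/-- `cl` is the discrete logarithm to base `α`, reduced modulo `3`. -/
def IsCubicIndex (α : Fˣ) (cl : F → ZMod 3) : Prop :=
  ∀ n : ℕ, cl ((α : F) ^ n) = n

theorem exists_pow_eq_of_ne_zero [Finite F] (hα : ∀ x : Fˣ, x ∈ Subgroup.zpowers α) {x : F}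
    (hx : x ≠ 0) : ∃ n : ℕ, (α : F) ^ n = x := by
  obtain ⟨n, hn⟩ := (mem_powers_iff_mem_zpowers (x := α) (y := Units.mk0 x hx)).mpr (hα _)
  exact ⟨n, by simpa using congrArg Units.val hn⟩

theorem pow_eq_one_iff_dvd [Fintype F] (hα : ∀ x : Fˣ, x ∈ Subgroup.zpowers α) (n : ℕ) :
    (α : F) ^ n = 1 ↔ Fintype.card F - 1 ∣ n := by
  rw [← Fintype.card_units, ← Nat.card_eq_fintype_card,
    ← orderOf_eq_card_of_forall_mem_zpowers hα, orderOf_dvd_iff_pow_eq_one, ← Units.val_pow_eq_pow_val,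
    Units.val_eq_one]

theorem exists_isCubicIndex [Fintype F] (hα : ∀ x : Fˣ, x ∈ Subgroup.zpowers α)
    (h3 : 3 ∣ Fintype.card F - 1) : ∃ cl : F → ZMod 3, IsCubicIndex α cl := by
  refine ⟨fun x => if h : ∃ n : ℕ, (α : F) ^ n = x then (h.choose : ZMod 3) else 0, fun n => ?_⟩
  have h : ∃ j : ℕ, (α : F) ^ j = (α : F) ^ n := ⟨n, rfl⟩
  simp only [h, dif_pos]
  rw [ZMod.natCast_eq_natCast_iff]
  have hs := h.choose_spec
  generalize h.choose = j at hs ⊢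
  rw [← Units.val_pow_eq_pow_val, ← Units.val_pow_eq_pow_val, Units.val_inj,
    pow_eq_pow_iff_modEq, orderOf_eq_card_of_forall_mem_zpowers hα, Nat.card_eq_fintype_card,
    Fintype.card_units] at hs
  exact hs.of_dvd h3

namespace IsCubicIndex

variable {cl : F → ZMod 3}

theorem map_mul [Finite F] (hcl : IsCubicIndex α cl) (hα : ∀ x : Fˣ, x ∈ Subgroup.zpowers α)
    {x y : F} (hx : x ≠ 0) (hy : y ≠ 0) : cl (x * y) = cl x + cl y := by
  obtain ⟨n, rfl⟩ := exists_pow_eq_of_ne_zero hα hx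
  obtain ⟨j, rfl⟩ := exists_pow_eq_of_ne_zero hα hy
  rw [← pow_add, hcl, hcl, hcl, Nat.cast_add]

theorem map_cube [Finite F] (hcl : IsCubicIndex α cl) (hα : ∀ x : Fˣ, x ∈ Subgroup.zpowers α)
    {x : F} (hx : x ≠ 0) : cl (x ^ 3) = 0 := by
  obtain ⟨n, rfl⟩ := exists_pow_eq_of_ne_zero hα hx
  rw [← pow_mul, hcl, Nat.cast_mul]
  exact mul_eq_zero_of_right _ rfl

theorem eq_zero_iff [Finite F] (hcl : IsCubicIndex α cl) (hα : ∀ x : Fˣ, x ∈ Subgroup.zpowers α)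
    {x : F} (hx : x ≠ 0) : cl x = 0 ↔ ∃ y : F, y ^ 3 = x := by
  constructor
  · obtain ⟨n, rfl⟩ := exists_pow_eq_of_ne_zero hα hx
    rw [hcl, ZMod.natCast_eq_zero_iff]
    rintro ⟨j, rfl⟩
    exact ⟨(α : F) ^ j, by rw [← pow_mul, mul_comm]⟩
  · rintro ⟨y, rfl⟩
    exact hcl.map_cube hα (by rintro rfl; simp at hx)

theorem map_neg [Finite F] (hcl : IsCubicIndex α cl) (hα : ∀ x : Fˣ, x ∈ Subgroup.zpowers α)
    {x : F} (hx : x ≠ 0) : cl (-x) = cl x := by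
  have h : cl (-1) = 0 := (hcl.eq_zero_iff hα (by simp)).mpr ⟨-1, by ring⟩
  rw [neg_eq_neg_one_mul, hcl.map_mul hα (by simp) hx, h, zero_add]

theorem mulChar_apply [Finite F] (hcl : IsCubicIndex α cl)
    (hα : ∀ x : Fˣ, x ∈ Subgroup.zpowers α) {χ : MulChar F ℂ} {ω : ℂ} (hω : ω ^ 3 = 1)
    (hχ : χ α = ω) {x : F} (hx : x ≠ 0) : χ x = ω ^ (cl x).val := by
  obtain ⟨n, rfl⟩ := exists_pow_eq_of_ne_zero hα hx
  rw [hcl, map_pow, hχ, ZMod.val_natCast, pow_eq_pow_mod n hω]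

theorem indicator_eq [Finite F] (hcl : IsCubicIndex α cl)
    (hα : ∀ x : Fˣ, x ∈ Subgroup.zpowers α) {χ : MulChar F ℂ} {ω : ℂ} (hω : ω ^ 2 = -1 - ω)
    (hχ : χ α = ω) (i : ZMod 3) (x : F) :
    (if x ≠ 0 ∧ cl x = i then 1 else 0 : ℂ) =
      ((1 : MulChar F ℂ) x + ω ^ (2 * i.val) * χ x + ω ^ i.val * (χ ^ 2) x) / 3 := by
  by_cases hx : x = 0
  · simp [hx, MulChar.map_zero]
  have h3 : ω ^ 3 = 1 := by linear_combination (ω - 1) * hω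
  have h4 : ω ^ 4 = ω := by linear_combination ω * h3
  have h6 : ω ^ 6 = 1 := by linear_combination (ω ^ 3 + 1) * h3
  have h5 : ω ^ 5 = -1 - ω := by linear_combination ω ^ 2 * h3 + hω
  have h8 : ω ^ 8 = -1 - ω := by linear_combination ω ^ 2 * h6 + hω
  rw [MulChar.pow_apply' _ two_ne_zero, hcl.mulChar_apply hα h3 hχ hx,
    MulChar.one_apply (isUnit_iff_ne_zero.mpr hx)]
  simp only [ne_eq, hx, not_false_eq_true, true_and]
  generalize cl x = c
  have hv0 : (0 : ZMod 3).val = 0 := rfl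
  have hv1 : (1 : ZMod 3).val = 1 := rfl
  have hv2 : (2 : ZMod 3).val = 2 := rfl
  have e01 : ¬ (0 : ZMod 3) = 1 := by decide
  have e10 : ¬ (1 : ZMod 3) = 0 := by decide
  have e02 : ¬ (0 : ZMod 3) = 2 := by decide
  have e20 : ¬ (2 : ZMod 3) = 0 := by decide
  have e12 : ¬ (1 : ZMod 3) = 2 := by decide
  have e21 : ¬ (2 : ZMod 3) = 1 := by decide
  have hc : c = 0 ∨ c = 1 ∨ c = 2 := by revert c; decide
  have hi : i = 0 ∨ i = 1 ∨ i = 2 := by revert i; decide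
  rcases hc with rfl | rfl | rfl <;> rcases hi with rfl | rfl | rfl <;>
  · simp only [hv0, hv1, hv2, e01, e10, e02, e20, e12, e21, if_true, if_false, ← pow_mul, ← pow_add]
    norm_num [hω, h3, h4, h5, h6, h8]
    try ring_nf
    try norm_num [hω, h3, h4, h5, h6, h8]

end IsCubicIndex

/-- The cyclotomic number of order `3`: the number of `x` with `x` and `1 - x` nonzero of
cubic index `i` and `j`. -/
noncomputable def cubicCyclotomicNumber [Fintype F] (cl : F → ZMod 3) (i j : ZMod 3) : ℂ :=
  ∑ x : F, (if x ≠ 0 ∧ cl x = i then 1 else 0) * (if 1 - x ≠ 0 ∧ cl (1 - x) = j then 1 else 0)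

theorem ZMod.sum_univ_three (f : ZMod 3 → ℂ) : ∑ i, f i = f 0 + f 1 + f 2 :=
  Fin.sum_univ_three f

namespace IsCubicIndex

theorem ne_one_of_apply {χ : MulChar F ℂ} {ω : ℂ} (hω : ω ^ 2 = -1 - ω) (hχ : χ α = ω) :
    χ ≠ 1 ∧ χ ^ 2 ≠ 1 := by
  constructor
  · rintro rfl
    rw [MulChar.one_apply_coe] at hχ
    rw [← hχ] at hω
    norm_num at hω
  · intro h
    have := congrArg (fun ξ : MulChar F ℂ => ξ α) h
    simp only [MulChar.pow_apply' _ two_ne_zero, hχ, MulChar.one_apply_coe] at this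
    rw [hω] at this
    have h2 : ω = -2 := by linear_combination -this
    rw [h2] at hω
    norm_num at hω

variable {cl : F → ZMod 3} [Fintype F]

theorem sum_indicator (hcl : IsCubicIndex α cl) (hα : ∀ x : Fˣ, x ∈ Subgroup.zpowers α)
    {χ : MulChar F ℂ} {ω : ℂ} (hω : ω ^ 2 = -1 - ω) (hχ : χ α = ω) (i : ZMod 3) :
    ∑ x : F, (if x ≠ 0 ∧ cl x = i then 1 else 0 : ℂ) = ((Fintype.card F : ℂ) - 1) / 3 := by
  obtain ⟨h1, h2⟩ := ne_one_of_apply hω hχ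
  simp only [hcl.indicator_eq hα hω hχ, ← Finset.sum_div, Finset.sum_add_distrib, ← Finset.mul_sum,
    MulChar.sum_eq_zero_of_ne_one h1, MulChar.sum_eq_zero_of_ne_one h2, MulChar.sum_one_eq_card_units]
  rw [Fintype.card_units, Nat.cast_sub Fintype.card_pos]
  simp

theorem cubicCyclotomicNumber_eq (hcl : IsCubicIndex α cl)
    (hα : ∀ x : Fˣ, x ∈ Subgroup.zpowers α) {χ : MulChar F ℂ} {ω : ℂ} (hω : ω ^ 2 = -1 - ω)
    (hχ : χ α = ω) (hχ3 : χ ^ 3 = 1) (i j : ZMod 3) :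
    cubicCyclotomicNumber cl i j = ((Fintype.card F : ℂ) - 2
      - ω ^ i.val - ω ^ (2 * i.val) - ω ^ j.val - ω ^ (2 * j.val)
      - ω ^ (2 * i.val) * ω ^ j.val - ω ^ i.val * ω ^ (2 * j.val)
      + ω ^ (2 * i.val) * ω ^ (2 * j.val) * jacobiSum χ χ
      + ω ^ i.val * ω ^ j.val * jacobiSum (χ ^ 2) (χ ^ 2)) / 9 := by
  obtain ⟨h1, h2⟩ := ne_one_of_apply hω hχ
  have hinv : χ ^ 2 = χ⁻¹ := (inv_eq_of_mul_eq_one_right (by rw [← hχ3, pow_succ' χ 2])).symm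
  have hneg : χ (-1) = 1 := by
    rw [show (-1 : F) = (-1) ^ 3 by ring, map_pow, ← MulChar.pow_apply' _ three_ne_zero, hχ3,
      MulChar.one_apply (by simp)]
  have j12 : jacobiSum χ (χ ^ 2) = -1 := by
    rw [hinv, jacobiSum_nontrivial_inv h1, hneg]
  have expand : cubicCyclotomicNumber cl i j = (jacobiSum (1 : MulChar F ℂ) 1
      + ω ^ (2 * j.val) * jacobiSum 1 χ + ω ^ j.val * jacobiSum 1 (χ ^ 2)
      + ω ^ (2 * i.val) * jacobiSum χ 1 + ω ^ i.val * jacobiSum (χ ^ 2) 1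
      + ω ^ (2 * i.val) * ω ^ j.val * jacobiSum χ (χ ^ 2)
      + ω ^ i.val * ω ^ (2 * j.val) * jacobiSum (χ ^ 2) χ
      + ω ^ (2 * i.val) * ω ^ (2 * j.val) * jacobiSum χ χ
      + ω ^ i.val * ω ^ j.val * jacobiSum (χ ^ 2) (χ ^ 2)) / 9 := by
    simp only [cubicCyclotomicNumber, hcl.indicator_eq hα hω hχ, jacobiSum, Finset.mul_sum,
      ← Finset.sum_add_distrib, Finset.sum_div]
    exact Finset.sum_congr rfl fun x _ => by ring
  rw [expand, jacobiSum_comm χ 1, jacobiSum_comm (χ ^ 2) 1, jacobiSum_comm (χ ^ 2) χ, j12,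
    jacobiSum_one_nontrivial h1, jacobiSum_one_nontrivial h2, jacobiSum_one_one]
  ring

theorem sum_comp (hcl : IsCubicIndex α cl) (hα : ∀ x : Fˣ, x ∈ Subgroup.zpowers α)
    {χ : MulChar F ℂ} {ω : ℂ} (hω : ω ^ 2 = -1 - ω) (hχ : χ α = ω) (f : ZMod 3 → ℂ) :
    ∑ x : F, (if x ≠ 0 then f (cl x) else 0) = ((Fintype.card F : ℂ) - 1) / 3 * ∑ i, f i := by
  rw [Finset.mul_sum]
  have h : ∀ i, ((Fintype.card F : ℂ) - 1) / 3 * f i =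
      ∑ x : F, (if x ≠ 0 ∧ cl x = i then 1 else 0) * f i := fun i => by
    rw [← Finset.sum_mul, hcl.sum_indicator hα hω hχ i]
  rw [Finset.sum_congr rfl fun i _ => h i, Finset.sum_comm]
  refine Finset.sum_congr rfl fun x _ => ?_
  by_cases hx : x = 0 <;> simp [hx]

theorem sum_comp_one_sub (f : ZMod 3 → ZMod 3 → ℂ) :
    ∑ x : F, (if x ≠ 0 ∧ 1 - x ≠ 0 then f (cl x) (cl (1 - x)) else 0) =
      ∑ i, ∑ j, cubicCyclotomicNumber cl i j * f i j := by
  simp_rw [cubicCyclotomicNumber, Finset.sum_mul]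
  rw [Finset.sum_congr rfl fun i _ => Finset.sum_comm, Finset.sum_comm]
  refine Finset.sum_congr rfl fun x _ => ?_
  by_cases hx : x = 0
  · simp [hx]
  by_cases hx' : 1 - x = 0
  · simp [hx']
  simp [hx, hx']

/-- Distribution of the triples `(η x, η y, η (x + y))` for a function `η` depending only on the
cubic index. -/
theorem sum_sum_comp (hcl : IsCubicIndex α cl) (hα : ∀ x : Fˣ, x ∈ Subgroup.zpowers α)
    {χ : MulChar F ℂ} {ω : ℂ} (hω : ω ^ 2 = -1 - ω) (hχ : χ α = ω) {η : F → ℂ} {E : ZMod 3 → ℂ}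
    (hη : ∀ x, x ≠ 0 → η x = E (cl x)) (G : ℂ → ℂ) :
    ∑ x : F, ∑ y : F, G (η x + η y + η (x + y)) =
      G (3 * η 0) + ((Fintype.card F : ℂ) - 1) * ∑ i, G (η 0 + 2 * E i) +
      ((Fintype.card F : ℂ) - 1) / 3 * ∑ k, ∑ i, ∑ j,
        cubicCyclotomicNumber cl i j * G (E (i + k) + E (j + k) + E k) := by
  have hneg : ∀ x, η (-x) = η x := by
    intro x
    by_cases hx : x = 0
    · simp [hx]
    rw [hη _ hx, hη _ (neg_ne_zero.mpr hx), hcl.map_neg hα hx]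
  have hz0 : ∑ x : F, G (η x + η (0 - x) + η 0) =
      G (3 * η 0) + ((Fintype.card F : ℂ) - 1) / 3 * ∑ i, G (η 0 + 2 * E i) := by
    rw [← hcl.sum_comp hα hω hχ (fun i => G (η 0 + 2 * E i)), Fintype.sum_eq_add_sum_compl 0,
      Fintype.sum_eq_add_sum_compl (0 : F) (fun x => ite (x ≠ 0) _ _)]
    simp only [ne_eq, not_true_eq_false, if_false, zero_add, sub_zero]
    congr 1
    · congr 1; ring
    · refine Finset.sum_congr rfl fun x hx => ?_
      have hx : x ≠ 0 := by simpa using hx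
      rw [if_pos hx, zero_sub, hneg, hη x hx]
      congr 1; ring
  have hz : ∀ z : F, z ≠ 0 → ∑ x : F, G (η x + η (z - x) + η z) =
      2 * G (η 0 + 2 * E (cl z)) + ∑ i, ∑ j, cubicCyclotomicNumber cl i j *
        G (E (i + cl z) + E (j + cl z) + E (cl z)) := by
    intro z hz
    rw [← sum_comp_one_sub (fun i j => G (E (i + cl z) + E (j + cl z) + E (cl z))),
      ← Equiv.sum_comp (Equiv.mulRight₀ z hz)]
    have hone : (1 : F) ∈ ({0}ᶜ : Finset F) := by simp
    rw [Fintype.sum_eq_add_sum_compl (0 : F), ← Finset.add_sum_erase _ _ hone,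
      Fintype.sum_eq_add_sum_compl (0 : F) (fun x => ite (_ ∧ _) _ _),
      ← Finset.add_sum_erase _ _ hone]
    simp only [Equiv.mulRight₀_apply, zero_mul, sub_zero, one_mul, sub_self, ne_eq,
      not_true_eq_false, false_and, and_false, if_false, zero_add]
    rw [← add_assoc]
    congr 1
    · rw [hη z hz, show η 0 + E (cl z) + E (cl z) = η 0 + 2 * E (cl z) by ring,
        show E (cl z) + η 0 + E (cl z) = η 0 + 2 * E (cl z) by ring]
      ring
    · refine Finset.sum_congr rfl fun x hx => ?_
      simp only [Finset.mem_erase, Finset.mem_compl, Finset.mem_singleton] at hx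
      have hx1 : 1 - x ≠ 0 := sub_ne_zero.mpr (Ne.symm hx.1)
      rw [if_pos ⟨hx.2, hx1⟩, hη _ (mul_ne_zero hx.2 hz), hcl.map_mul hα hx.2 hz,
        show z - x * z = (1 - x) * z by ring, hη _ (mul_ne_zero hx1 hz), hcl.map_mul hα hx1 hz,
        hη z hz]
  have hsum : ∑ x : F, ∑ y : F, G (η x + η y + η (x + y)) =
      ∑ z : F, ∑ x : F, G (η x + η (z - x) + η z) := by
    rw [Finset.sum_comm (f := fun z x => G (η x + η (z - x) + η z))]
    refine Finset.sum_congr rfl fun x _ => ?_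
    rw [← Equiv.sum_comp (Equiv.addLeft x) (fun z => G (η x + η (z - x) + η z))]
    simp
  rw [hsum, Fintype.sum_eq_add_sum_compl 0, hz0]
  have hrest : ∑ z ∈ ({0}ᶜ : Finset F), ∑ x : F, G (η x + η (z - x) + η z) =
      ((Fintype.card F : ℂ) - 1) / 3 * ∑ k, (2 * G (η 0 + 2 * E k) +
        ∑ i, ∑ j, cubicCyclotomicNumber cl i j * G (E (i + k) + E (j + k) + E k)) := by
    rw [← hcl.sum_comp hα hω hχ, Fintype.sum_eq_add_sum_compl (0 : F) (fun x => ite (x ≠ 0) _ _)]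
    simp only [ne_eq, not_true_eq_false, if_false, zero_add]
    refine Finset.sum_congr rfl fun z hz' => ?_
    have hz' : z ≠ 0 := by simpa using hz'
    rw [if_pos hz', hz z hz']
  rw [hrest, Finset.sum_add_distrib, ← Finset.mul_sum]
  ring

end IsCubicIndex

end CubicIndex

section PeriodSums

variable {K F : Type*} [Field K] [Field F] [Algebra K F] [Fintype K]

theorem exists_algebraMap_eq_of_pow_card_eq {x : F} (hx : x ^ Fintype.card K = x) :
    ∃ y : K, algebraMap K F y = x := by
  have hq := Fintype.one_lt_card (α := K)
  have hne : (Polynomial.X ^ Fintype.card K - Polynomial.X : Polynomial F) ≠ 0 :=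
    FiniteField.X_pow_card_sub_X_ne_zero F hq
  have hsub : Finset.univ.image (algebraMap K F) ⊆
      (Polynomial.X ^ Fintype.card K - Polynomial.X : Polynomial F).roots.toFinset := by
    intro z hz
    obtain ⟨y, -, rfl⟩ := Finset.mem_image.mp hz
    rw [Multiset.mem_toFinset, Polynomial.mem_roots hne]
    simp [← map_pow, FiniteField.pow_card]
  have heq := Finset.eq_of_subset_of_card_le hsub (by
    rw [Finset.card_image_of_injective _ (algebraMap K F).injective, Finset.card_univ]
    refine (Multiset.toFinset_card_le _).trans ((Polynomial.card_roots' _).trans ?_)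
    rw [FiniteField.X_pow_card_sub_X_natDegree_eq F hq])
  have hmem : x ∈ Finset.univ.image (algebraMap K F) := by
    rw [heq, Multiset.mem_toFinset, Polynomial.mem_roots hne]
    simp [hx]
  simpa using hmem

theorem sum_stdAddChar_trace [Finite F] {p : ℕ} [Fact p.Prime] [Algebra (ZMod p) F] (z : F) :
    ∑ y : K, ZMod.stdAddChar (Algebra.trace (ZMod p) F (algebraMap K F y * z)) =
      if Algebra.trace K F z = 0 then (Fintype.card K : ℂ) else 0 := by
  have : CharP F p := charP_of_injective_algebraMap (algebraMap (ZMod p) F).injective p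
  have : CharP K p := (RingHom.charP_iff (algebraMap K F) (algebraMap K F).injective p).mpr this
  let _ : Algebra (ZMod p) K := ZMod.algebra K p
  have : IsScalarTower (ZMod p) K F := IsScalarTower.of_algebraMap_eq' (Subsingleton.elim _ _)
  have htr : ∀ y : K, Algebra.trace (ZMod p) F (algebraMap K F y * z) =
      Algebra.trace (ZMod p) K (y * Algebra.trace K F z) := by
    intro y
    rw [← Algebra.trace_trace (S := K), ← Algebra.smul_def, map_smul, smul_eq_mul]
  let Ψ : AddChar K ℂ := (ZMod.stdAddChar (N := p)).compAddMonoidHom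
    (Algebra.trace (ZMod p) K).toAddMonoidHom
  have hΨ : Ψ.IsPrimitive := by
    refine AddChar.IsPrimitive.of_ne_one fun h => ?_
    obtain ⟨b, hb⟩ := Algebra.trace_surjective (ZMod p) K 1
    have h1 : ZMod.stdAddChar (N := p) 1 = 1 := by
      rw [← hb]; exact congrArg (fun ξ : AddChar K ℂ => ξ b) h
    rw [← AddChar.map_zero_eq_one (ZMod.stdAddChar (N := p))] at h1
    exact one_ne_zero (ZMod.injective_stdAddChar h1)
  simp_rw [htr]
  have := AddChar.sum_mulShift (Algebra.trace K F z) hΨ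
  push_cast at this
  convert this using 2
  rfl

end PeriodSums

section CubicPeriod

variable {F : Type*} [Field F] [Fintype F] {α : Fˣ}

/-- The cubic period of `ψ` at `u`: the sum of `ψ (z * u)` over the nonzero cubes `z`. -/
noncomputable def cubicPeriod (ψ : F → ℂ) (u : F) : ℂ :=
  ∑ z ∈ Finset.univ.filter (fun x : F => x ≠ 0 ∧ ∃ y : F, y ^ 3 = x), ψ (z * u)

theorem cubicPeriod_cube_mul (ψ : F → ℂ) {w : F} (hw : w ≠ 0) (u : F) :
    cubicPeriod ψ (w ^ 3 * u) = cubicPeriod ψ u := by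
  unfold cubicPeriod
  refine Finset.sum_nbij' (· * w ^ 3) (· * (w⁻¹) ^ 3) ?_ ?_ ?_ ?_ ?_
  · simp only [Finset.mem_filter, Finset.mem_univ, true_and]
    rintro _ ⟨hz, y, rfl⟩
    exact ⟨mul_ne_zero hz (pow_ne_zero 3 hw), y * w, mul_pow _ _ _⟩
  · simp only [Finset.mem_filter, Finset.mem_univ, true_and]
    rintro _ ⟨hz, y, rfl⟩
    exact ⟨mul_ne_zero hz (pow_ne_zero 3 (inv_ne_zero hw)), y * w⁻¹, mul_pow _ _ _⟩
  · intro z _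
    field_simp
  · intro z _
    field_simp
  · intro z _
    rw [mul_assoc]

namespace IsCubicIndex

variable {cl : F → ZMod 3}

theorem cubicPeriod_eq (hcl : IsCubicIndex α cl) (hα : ∀ x : Fˣ, x ∈ Subgroup.zpowers α)
    (ψ : F → ℂ) {x : F} (hx : x ≠ 0) :
    cubicPeriod ψ x = cubicPeriod ψ ((α : F) ^ (cl x).val) := by
  obtain ⟨n, rfl⟩ := exists_pow_eq_of_ne_zero hα hx
  rw [hcl, ZMod.val_natCast]
  conv_lhs => rw [← Nat.div_add_mod n 3, pow_add, mul_comm 3, pow_mul]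
  exact cubicPeriod_cube_mul ψ (pow_ne_zero _ α.ne_zero) _

theorem card_cubes (hcl : IsCubicIndex α cl) (hα : ∀ x : Fˣ, x ∈ Subgroup.zpowers α)
    {χ : MulChar F ℂ} {ω : ℂ} (hω : ω ^ 2 = -1 - ω) (hχ : χ α = ω) :
    ((Finset.univ.filter (fun x : F => x ≠ 0 ∧ ∃ y : F, y ^ 3 = x)).card : ℂ) =
      ((Fintype.card F : ℂ) - 1) / 3 := by
  rw [← hcl.sum_indicator hα hω hχ 0, Finset.sum_boole]
  congr 2
  ext x
  simp only [Finset.mem_filter, Finset.mem_univ, true_and, and_congr_right_iff]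
  exact fun hx => (hcl.eq_zero_iff hα hx).symm

theorem cubicPeriod_sum (hcl : IsCubicIndex α cl) (hα : ∀ x : Fˣ, x ∈ Subgroup.zpowers α)
    (ψ : F → ℂ) : ∑ i : ZMod 3, cubicPeriod ψ ((α : F) ^ i.val) = ∑ x, ψ x - ψ 0 := by
  have key : ∀ i : ZMod 3, cubicPeriod ψ ((α : F) ^ i.val) =
      ∑ x ∈ Finset.univ.filter (fun x : F => x ≠ 0 ∧ cl x = i), ψ x := by
    intro i
    have hα0 : (α : F) ^ i.val ≠ 0 := pow_ne_zero _ α.ne_zero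
    have hcli : cl ((α : F) ^ i.val) = i := by rw [hcl, ZMod.natCast_zmod_val]
    unfold cubicPeriod
    refine Finset.sum_nbij' (· * (α : F) ^ i.val) (· / (α : F) ^ i.val) ?_ ?_ ?_ ?_ ?_
    · simp only [Finset.mem_filter, Finset.mem_univ, true_and]
      rintro z ⟨hz, hy⟩
      refine ⟨mul_ne_zero hz hα0, ?_⟩
      rw [hcl.map_mul hα hz hα0, (hcl.eq_zero_iff hα hz).mpr hy, hcli, zero_add]
    · simp only [Finset.mem_filter, Finset.mem_univ, true_and]
      rintro z ⟨hz, hzi⟩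
      have hd := div_ne_zero hz hα0
      refine ⟨hd, (hcl.eq_zero_iff hα hd).mp ?_⟩
      have := hcl.map_mul hα hd hα0
      rw [div_mul_cancel₀ _ hα0, hzi, hcli] at this
      exact left_eq_add.mp (this.trans (add_comm _ _))
    · intro z _
      field_simp
    · intro z _
      field_simp
    · intro z _
      rfl
  rw [Finset.sum_congr rfl fun i _ => key i, eq_sub_iff_add_eq, ← Finset.sum_erase_add _ _
    (Finset.mem_univ (0 : F)), ← Finset.sum_fiberwise (Finset.univ.erase (0 : F)) cl ψ]
  congr 1
  refine Finset.sum_congr rfl fun i _ => Finset.sum_congr ?_ fun _ _ => rfl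
  ext x
  simp

end IsCubicIndex

/-- The group of units under which `S` is invariant. -/
def invariantUnits (S : F → ℂ) : Subgroup Fˣ where
  carrier := {w | ∀ u, S (w * u) = S u}
  one_mem' := fun u => by simp
  mul_mem' := fun {a b} ha hb u => by rw [Units.val_mul, mul_assoc, ha, hb]
  inv_mem' := fun {a} ha u => by rw [← ha, Units.mul_inv_cancel_left]

theorem Subgroup.pow_gcd_mem {G : Type*} [Group G] (H : Subgroup G) {a : G} {k l : ℕ}
    (hk : a ^ k ∈ H) (hl : a ^ l ∈ H) : a ^ Nat.gcd k l ∈ H := by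
  rw [← zpow_natCast, Nat.gcd_eq_gcd_ab, zpow_add, zpow_mul, zpow_mul, zpow_natCast, zpow_natCast]
  exact H.mul_mem (H.zpow_mem hk _) (H.zpow_mem hl _)

variable {K : Type*} [Field K] [Fintype K] [Algebra K F]

theorem sum_sum_eq_mul_cubicPeriod {cl : F → ZMod 3} (hcl : IsCubicIndex α cl)
    (hα : ∀ x : Fˣ, x ∈ Subgroup.zpowers α)
    {χ : MulChar F ℂ} {ω : ℂ} (hω : ω ^ 2 = -1 - ω) (hχ : χ α = ω) {h d t : ℕ}
    (hd : h * d = Fintype.card K - 1) (ht : Fintype.card F - 1 = 3 * t * (Fintype.card K - 1))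
    (hgcd : Nat.gcd (3 * t) (3 * d) = 3) (ψ : F → ℂ) (u : F) :
    ∑ j ∈ Finset.range (h * t), ∑ y : Kˣ, ψ (algebraMap K F y * (((α : F) ^ d) ^ 3) ^ j * u) =
      h * cubicPeriod ψ u := by
  set S : F → ℂ := fun u => ∑ j ∈ Finset.range (h * t), ∑ y : Kˣ,
    ψ (algebraMap K F y * (((α : F) ^ d) ^ 3) ^ j * u) with hS
  have hK : 1 < Fintype.card K := Fintype.one_lt_card
  have hF : 1 < Fintype.card F := Fintype.one_lt_card
  have hmemK : ∀ w : Fˣ, (∃ y : K, algebraMap K F y = w) → w ∈ invariantUnits S := by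
    rintro w ⟨y, hy⟩ u
    have hy0 : y ≠ 0 := by rintro rfl; exact w.ne_zero (by rw [← hy, map_zero])
    refine Finset.sum_congr rfl fun j _ => ?_
    rw [← Equiv.sum_comp (Equiv.mulRight (Units.mk0 y hy0)) (fun z : Kˣ =>
      ψ (algebraMap K F z * (((α : F) ^ d) ^ 3) ^ j * u))]
    refine Finset.sum_congr rfl fun z _ => ?_
    rw [Equiv.coe_mulRight, Units.val_mul, Units.val_mk0, _root_.map_mul, hy]
    ring_nf
  have hM : α ^ (3 * t) ∈ invariantUnits S := by
    refine hmemK _ (exists_algebraMap_eq_of_pow_card_eq ?_)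
    have h1 : (α : F) ^ (3 * t * (Fintype.card K - 1)) = 1 :=
      (pow_eq_one_iff_dvd hα _).mpr (by rw [ht])
    rw [Units.val_pow_eq_pow_val, ← pow_mul]
    conv_lhs => rw [← Nat.sub_add_cancel hK.le, mul_add, pow_add, h1, one_mul, mul_one]
  have hg1 : (((α : F) ^ d) ^ 3) ^ (h * t) = 1 := by
    rw [← pow_mul, ← pow_mul, pow_eq_one_iff_dvd hα, ht, ← hd]
    exact dvd_of_eq (by ring)
  have hg : α ^ (3 * d) ∈ invariantUnits S := by
    intro u
    have hshift : ∀ f : ℕ → ℂ, f (h * t) = f 0 →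
        ∑ j ∈ Finset.range (h * t), f (j + 1) = ∑ j ∈ Finset.range (h * t), f j := by
      intro f hf
      have h1 := Finset.sum_range_succ f (h * t)
      have h2 := Finset.sum_range_succ' f (h * t)
      linear_combination h2.symm.trans h1 + hf
    rw [hS]
    simp only
    rw [← hshift (fun j => ∑ y : Kˣ, ψ (algebraMap K F y * (((α : F) ^ d) ^ 3) ^ j * u))
      (by simp only [hg1, pow_zero])]
    refine Finset.sum_congr rfl fun j _ => Finset.sum_congr rfl fun y _ => ?_
    rw [Units.val_pow_eq_pow_val]
    ring_nf
  have hcube : ∀ w : F, w ≠ 0 → ∀ u, S (w ^ 3 * u) = S u := by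
    intro w hw u
    obtain ⟨k, rfl⟩ := exists_pow_eq_of_ne_zero hα hw
    have := (invariantUnits S).pow_mem ((invariantUnits S).pow_gcd_mem hM hg) k u
    rw [hgcd] at this
    rw [← this]
    push_cast
    ring_nf
  have hyc : ∀ y : Kˣ, ∃ w : F, w ≠ 0 ∧ algebraMap K F y = w ^ 3 := by
    intro y
    have hy0 : algebraMap K F y ≠ 0 := by simp
    obtain ⟨k, hk⟩ := exists_pow_eq_of_ne_zero hα hy0
    have h1 : (algebraMap K F y) ^ (Fintype.card K - 1) = 1 := by
      rw [← _root_.map_pow, FiniteField.pow_card_sub_one_eq_one _ y.ne_zero, map_one]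
    rw [← hk, ← pow_mul, pow_eq_one_iff_dvd hα, ht] at h1
    obtain ⟨c, rfl⟩ := (Dvd.intro t rfl).trans (Nat.dvd_of_mul_dvd_mul_right (by omega) h1)
    exact ⟨(α : F) ^ c, pow_ne_zero _ α.ne_zero, by rw [← hk]; ring⟩
  set C := Finset.univ.filter (fun x : F => x ≠ 0 ∧ ∃ y : F, y ^ 3 = x) with hC
  have hsum : ∑ z ∈ C, S (z * u) = C.card * S u := by
    rw [Finset.sum_congr rfl (g := fun _ => S u), Finset.sum_const, nsmul_eq_mul]
    intro z hz
    obtain ⟨hz0, y, rfl⟩ := (Finset.mem_filter.mp hz).2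
    exact hcube y (by rintro rfl; simp at hz0) u
  have hsum' : ∑ z ∈ C, S (z * u) = (h * t : ℕ) * (Fintype.card K - 1 : ℕ) * cubicPeriod ψ u := by
    rw [hS, Finset.sum_comm]
    rw [Finset.sum_congr rfl (g := fun _ => ((Fintype.card K - 1 : ℕ) : ℂ) * cubicPeriod ψ u),
      Finset.sum_const, Finset.card_range, nsmul_eq_mul, mul_assoc]
    intro j _
    rw [Finset.sum_comm, Finset.sum_congr rfl (g := fun _ => cubicPeriod ψ u), Finset.sum_const,
      Finset.card_univ, Fintype.card_units, nsmul_eq_mul]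
    intro y _
    obtain ⟨w, hw, hyw⟩ := hyc y
    rw [← cubicPeriod_cube_mul ψ (mul_ne_zero hw (pow_ne_zero j (pow_ne_zero d α.ne_zero))) u]
    unfold cubicPeriod
    refine Finset.sum_congr rfl fun z _ => ?_
    rw [hyw]
    ring_nf
  have hcard := hcl.card_cubes hα hω hχ
  rw [← hC] at hcard
  have hcF : ((Fintype.card F : ℂ) - 1) = 3 * t * (Fintype.card K - 1 : ℕ) := by
    rw [← Nat.cast_one, ← Nat.cast_sub hF.le, ht]
    push_cast
    ring
  have hne : (t : ℂ) * (Fintype.card K - 1 : ℕ) ≠ 0 := by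
    rw [← Nat.cast_mul, Nat.cast_ne_zero]
    intro h0
    have : 3 * t * (Fintype.card K - 1) = 0 := by rw [mul_assoc, h0, mul_zero]
    omega
  rw [hsum, hcard, hcF] at hsum'
  push_cast at hsum' hne
  refine mul_left_cancel₀ hne ?_
  show _ * S u = _
  linear_combination hsum'

end CubicPeriod

section ModifiedWeight

/-- The additive character of `F` attached to the trace to the prime field. -/
noncomputable def traceChar (p : ℕ) [NeZero p] (F : Type*) [Field F] [Algebra (ZMod p) F] :
    F → ℂ := fun x => ZMod.stdAddChar (Algebra.trace (ZMod p) F x)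

theorem traceChar_zero {F : Type*} [Field F] {p : ℕ} [NeZero p] [Algebra (ZMod p) F] :
    traceChar p F 0 = 1 := by
  rw [traceChar, map_zero, AddChar.map_zero_eq_one]

variable {K F : Type*} [Field K] [Field F] [Algebra K F] [Fintype K] [Fintype F]

theorem Fintype.sum_eq_add_sum_units (f : K → ℂ) : ∑ y, f y = f 0 + ∑ y : Kˣ, f y := by
  rw [Fintype.sum_eq_add_sum_subtype_ne f 0]
  congr 1
  exact (Equiv.sum_comp unitsEquivNeZero (fun y : {y : K // y ≠ 0} => f y)).symm

theorem Finset.sum_range_three_mul (f : ℕ → ℂ) (n : ℕ) :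
    ∑ i ∈ Finset.range (3 * n), f i =
      ∑ j ∈ Finset.range n, (f (3 * j) + f (3 * j + 1) + f (3 * j + 2)) := by
  induction n with
  | zero => simp
  | succ n ih =>
    rw [Finset.sum_range_succ, ← ih, mul_add, mul_one, Finset.sum_range_succ,
      Finset.sum_range_succ, Finset.sum_range_succ]
    ring

variable {p : ℕ} [Fact p.Prime] [Algebra (ZMod p) F]

theorem sum_traceChar : ∑ x, traceChar p F x = 0 := by
  simpa [traceChar] using sum_stdAddChar_trace (K := F) (p := p) (1 : F)

theorem card_mul_ncard_trace_ne_zero {n : ℕ} (f : ℕ → F) :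
    (Fintype.card K : ℂ) * (Set.ncard {i : Fin n | Algebra.trace K F (f i) ≠ 0} : ℂ) =
      ((Fintype.card K : ℂ) - 1) * n -
        ∑ i ∈ Finset.range n, ∑ y : Kˣ, traceChar p F (algebraMap K F y * f i) := by
  have hy : ∀ z : F, ∑ y : Kˣ, traceChar p F (algebraMap K F y * z) =
      (Fintype.card K : ℂ) - 1 - Fintype.card K * if Algebra.trace K F z ≠ 0 then 1 else 0 := by
    intro z
    have h1 := sum_stdAddChar_trace (K := K) (p := p) z
    have h2 := Fintype.sum_eq_add_sum_units
      (fun y : K => traceChar p F (algebraMap K F y * z))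
    rw [map_zero, zero_mul, traceChar_zero] at h2
    have h3 := h2.symm.trans h1
    rw [ite_not]
    split_ifs at h3 ⊢ <;> linear_combination h3
  rw [Finset.sum_congr rfl fun i _ => hy (f i), Finset.sum_sub_distrib, Finset.sum_const,
    Finset.card_range, nsmul_eq_mul, ← Finset.mul_sum, Finset.sum_range
      (fun i => if Algebra.trace K F (f i) ≠ 0 then (1 : ℂ) else 0), Finset.sum_boole,
    Set.ncard_eq_toFinset_card']
  simp only [Set.toFinset_ofPred]
  ring

/-- The modified weight of a codeword, in terms of cubic periods. -/
theorem modifiedWeight_eq {α : Fˣ} {cl : F → ZMod 3} (hcl : IsCubicIndex α cl)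
    (hα : ∀ x : Fˣ, x ∈ Subgroup.zpowers α)
    {χ : MulChar F ℂ} {ω : ℂ} (hω : ω ^ 2 = -1 - ω) (hχ : χ α = ω) {h d t : ℕ}
    (hd : h * d = Fintype.card K - 1) (ht : Fintype.card F - 1 = 3 * t * (Fintype.card K - 1))
    (hgcd : Nat.gcd (3 * t) (3 * d) = 3) (hd3 : 3 ∣ d) {β : F} (hβ : β ^ 3 = 1) (a b : F) :
    (h : ℂ) * ((Fintype.card F : ℂ) - 1) / Fintype.card K -
      (Set.ncard {i : Fin (3 * (h * t)) | Algebra.trace K F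
        (a * ((α : F) ^ d) ^ (i : ℕ) + b * (β * (α : F) ^ d) ^ (i : ℕ)) ≠ 0} : ℂ) =
      (h : ℂ) / Fintype.card K * (cubicPeriod (traceChar p F) (a + b) +
        cubicPeriod (traceChar p F) (a + b * β) + cubicPeriod (traceChar p F) (a + b * β ^ 2)) := by
  have hK : (Fintype.card K : ℂ) ≠ 0 := Nat.cast_ne_zero.mpr Fintype.card_ne_zero
  have hcard := card_mul_ncard_trace_ne_zero (K := K) (p := p) (n := 3 * (h * t))
    (fun i => a * ((α : F) ^ d) ^ i + b * (β * (α : F) ^ d) ^ i)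
  have hpow : ∀ (k : ℕ) (v : F), cubicPeriod (traceChar p F) (((α : F) ^ d) ^ k * v) =
      cubicPeriod (traceChar p F) v := by
    intro k v
    obtain ⟨c, rfl⟩ := hd3
    rw [← cubicPeriod_cube_mul _ (pow_ne_zero (c * k) α.ne_zero) v]
    ring_nf
  have hterm : ∀ k, ∑ j ∈ Finset.range (h * t), ∑ y : Kˣ, traceChar p F (algebraMap K F y *
      (a * ((α : F) ^ d) ^ (3 * j + k) + b * (β * (α : F) ^ d) ^ (3 * j + k))) =
      h * cubicPeriod (traceChar p F) (a + b * β ^ k) := by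
    intro k
    rw [← hpow k, ← sum_sum_eq_mul_cubicPeriod hcl hα hω hχ hd ht hgcd]
    refine Finset.sum_congr rfl fun j _ => Finset.sum_congr rfl fun y _ => ?_
    rw [mul_pow β, pow_add β, pow_mul β, hβ, one_pow, one_mul, pow_add _ (3 * j), pow_mul _ 3 j]
    congr 1
    ring
  have h0 := hterm 0
  have h1 := hterm 1
  have h2 := hterm 2
  simp only [add_zero, pow_zero, mul_one, pow_one] at h0 h1
  rw [Finset.sum_range_three_mul, Finset.sum_add_distrib, Finset.sum_add_distrib, h0, h1, h2]
    at hcard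
  have hcF : ((Fintype.card F : ℂ) - 1) = 3 * t * ((Fintype.card K : ℂ) - 1) := by
    rw [← Nat.cast_one, ← Nat.cast_sub Fintype.card_pos, ht, ← Nat.cast_sub Fintype.card_pos]
    push_cast
    ring
  rw [hcF, ← mul_right_inj' hK, mul_sub, hcard]
  push_cast
  field_simp
  ring

/-- Reindexing of sums over pairs by a linear bijection attached to a primitive cube root of
unity `β`. -/
theorem sum_prod_comp_of_cube {η : F → ℂ} {β : F} (hβ2 : β ^ 2 + β + 1 = 0) (hβ1 : β ≠ 1)
    (hη : ∀ x, η (β * x) = η x) (hneg : ∀ x, η (-x) = η x) (G : ℂ → ℂ) :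
    ∑ ab : F × F, G (η (ab.1 + ab.2) + η (ab.1 + ab.2 * β) + η (ab.1 + ab.2 * β ^ 2)) =
      ∑ x, ∑ y, G (η x + η y + η (x + y)) := by
  have hβ3 : β ^ 3 = 1 := by linear_combination (β - 1) * hβ2
  have hβ0 : β ≠ 0 := by rintro rfl; simp at hβ3
  rw [← Fintype.sum_prod_type' (fun x y => G (η x + η y + η (x + y)))]
  let e : F × F → F × F := fun ab => (β * (ab.1 + ab.2 * β), β * (β * (ab.1 + ab.2 * β ^ 2)))
  have hinj : Function.Injective e := by
    rintro ⟨a, b⟩ ⟨a', b'⟩ hab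
    simp only [e, Prod.mk.injEq, mul_right_inj' hβ0] at hab
    have hb : b = b' := by
      refine mul_right_cancel₀ (mul_ne_zero hβ0 (sub_ne_zero.mpr hβ1)) ?_
      linear_combination hab.2 - hab.1
    subst hb
    exact Prod.ext (add_right_cancel hab.1) rfl
  refine Fintype.sum_bijective e (Finite.injective_iff_bijective.mp hinj) _ _ fun ab => ?_
  have hs : (e ab).1 + (e ab).2 = -(ab.1 + ab.2) := by
    simp only [e]
    linear_combination (ab.1 + ab.2 * β ^ 2 - ab.2 * β + ab.2) * hβ2
  rw [hs, hneg]
  simp only [e, hη]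
  congr 1
  ring

end ModifiedWeight

namespace EisensteinInt

open QuadraticAlgebra

theorem exists_ringHom {R : Type*} [CommRing R] {w : R} (hw : w ^ 2 = -1 - w) :
    ∃ φ : EisensteinInt →+* R, φ omega = w := by
  let φ : EisensteinInt →ₐ[ℤ] R := QuadraticAlgebra.lift ⟨w, by
    rw [← pow_two, hw]; simp; ring⟩
  exact ⟨φ.toRingHom, by simp [φ]⟩

variable {F : Type*} [Field F] [Fintype F] {α : Fˣ}

theorem exists_mulChar (hα : ∀ x : Fˣ, x ∈ Subgroup.zpowers α) (h3 : 3 ∣ Fintype.card F - 1) :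
    ∃ χ : MulChar F EisensteinInt, χ α = omega ∧ χ ^ 3 = 1 ∧ χ ≠ 1 := by
  obtain ⟨ζ, hζ⟩ : ∃ ζ : EisensteinIntˣ, (ζ : EisensteinInt) = omega :=
    isPrimitiveRoot_omega.isUnit three_ne_zero
  have hζ3 : ζ ^ 3 = 1 := by
    ext1; rw [Units.val_pow_eq_pow_val, hζ, omega_pow_three, Units.val_one]
  have hmem : ζ ∈ rootsOfUnity (Fintype.card Fˣ) EisensteinInt := by
    obtain ⟨k, hk⟩ := h3
    rw [mem_rootsOfUnity, Fintype.card_units, hk, pow_mul, hζ3, one_pow]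
  have hχ : MulChar.ofRootOfUnity hmem hα α = omega := by
    rw [MulChar.ofRootOfUnity_spec, hζ]
  refine ⟨MulChar.ofRootOfUnity hmem hα, hχ, ?_, fun h => ?_⟩
  · rw [MulChar.eq_iff hα, MulChar.pow_apply_coe, hχ, omega_pow_three, MulChar.one_apply_coe]
  · rw [h, MulChar.one_apply_coe] at hχ
    simpa using congrArg QuadraticAlgebra.im hχ

/-- Evaluation of the Jacobi sums of the cubic character sending the generator `α` to a
primitive cube root of unity `ζ`. -/
theorem exists_mulChar_complex {p l k : ℕ} [Fact p.Prime] [CharP F p] (hp : p % 3 = 1)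
    (hF : Fintype.card F = p ^ l) (hk : p ^ l = 3 * k + 1)
    (hα : ∀ x : Fˣ, x ∈ Subgroup.zpowers α) {ζ : ℂ} (hζ : ζ ^ 2 = -1 - ζ) {a b : ℤ}
    (hab : (p : ℤ) = a ^ 2 - a * b + b ^ 2) (ha : a % 3 = 2) (hb : b % 3 = 0)
    (hβ : ((α : F) ^ k) ^ 2 = -1 - (α : F) ^ k) :
    ∃ χ : MulChar F ℂ, χ α = ζ ∧ χ ^ 3 = 1 ∧
      ((a + b * (α : F) ^ k = 0 ∧ jacobiSum χ χ = (-1) ^ (l + 1) * (a + b * ζ) ^ l ∧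
          jacobiSum (χ ^ 2) (χ ^ 2) = (-1) ^ (l + 1) * (a + b * ζ ^ 2) ^ l) ∨
        (a + b * ((α : F) ^ k) ^ 2 = 0 ∧ jacobiSum χ χ = (-1) ^ (l + 1) * (a + b * ζ ^ 2) ^ l ∧
          jacobiSum (χ ^ 2) (χ ^ 2) = (-1) ^ (l + 1) * (a + b * ζ) ^ l)) := by
  obtain ⟨ι, hι⟩ := exists_ringHom hζ
  obtain ⟨φ, hφ⟩ := exists_ringHom hβ
  obtain ⟨χ, hχα, hχ3, hχ1⟩ := exists_mulChar hα (by rw [hF, hk]; simp)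
  have hk0 : k ≠ 0 := by
    rintro rfl
    have := Fintype.one_lt_card (α := F)
    omega
  have hφχ : ∀ x, φ (χ x) = x ^ k := by
    intro x
    by_cases hx : x = 0
    · rw [hx, MulChar.map_zero, map_zero, zero_pow hk0]
    obtain ⟨n, rfl⟩ := exists_pow_eq_of_ne_zero hα hx
    rw [map_pow, hχα, map_pow, hφ, ← pow_mul, ← pow_mul, mul_comm]
  have hinv : χ⁻¹ = χ ^ 2 := inv_eq_of_mul_eq_one_right (by rw [← hχ3, pow_succ' χ 2])
  have hJ2 : jacobiSum (χ.ringHomComp ι ^ 2) (χ.ringHomComp ι ^ 2) = ι (star (jacobiSum χ χ)) := by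
    rw [star_jacobiSum hχ3, hinv, MulChar.ringHomComp_pow, jacobiSum_ringHomComp]
  set π : EisensteinInt := ⟨a, b⟩ with hπ
  have hnorm : π.norm = p := by rw [norm_eq, hab]
  have hιπ : ι π = a + b * ζ := by rw [map_eq, hι]
  have hιs : ι (star π) = a + b * ζ ^ 2 := by
    rw [map_eq, hι, hζ, hπ]; simp; ring
  have hφπ : φ π = a + b * (α : F) ^ k := by rw [map_eq, hφ]
  have hφs : φ (star π) = a + b * ((α : F) ^ k) ^ 2 := by
    rw [map_eq, hφ, hβ, hπ]; simp; ring
  have h3 : (3 : EisensteinInt) ∣ π + 1 :=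
    ⟨⟨(a + 1) / 3, b / 3⟩, by ext <;> simp [hπ] <;> omega⟩
  have h3s : (3 : EisensteinInt) ∣ star π + 1 := by
    obtain ⟨c, hc⟩ := h3
    exact ⟨star c, by simpa using congrArg star hc⟩
  refine ⟨χ.ringHomComp ι, by rw [MulChar.ringHomComp_apply, hχα, hι], by
    rw [MulChar.ringHomComp_pow, hχ3, MulChar.ringHomComp_one], ?_⟩
  rw [hJ2, jacobiSum_ringHomComp]
  have hzero : φ π * φ (star π) = 0 := by
    rw [← map_mul, mul_star_eq, hnorm]; simp
  rcases mul_eq_zero.mp hzero with h0 | h0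
  · left
    rw [jacobiSum_eq hp hF hk ι hχ3 hχ1 φ hφχ hnorm h0 h3]
    refine ⟨by rw [← hφπ, h0], by simp [hιπ], by simp [hιs]⟩
  · right
    have hnorm' : (star π).norm = p := by rw [← hnorm, norm_eq, norm_eq]; simp; ring
    rw [jacobiSum_eq hp hF hk ι hχ3 hχ1 φ hφχ hnorm' h0 h3s]
    refine ⟨by rw [← hφs, h0], by simp [hιs], by simp [hιπ]⟩

end EisensteinInt

/-- Explicit form of the distribution of `η x + η y + η (x + y)` for a function `η` depending only
on the cubic index. -/
theorem IsCubicIndex.sum_sum_comp_explicit {F : Type*} [Field F] [Fintype F] {α : Fˣ}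
    {cl : F → ZMod 3} (hcl : IsCubicIndex α cl) (hα : ∀ x : Fˣ, x ∈ Subgroup.zpowers α)
    {χ : MulChar F ℂ} {ω : ℂ} (hω : ω ^ 2 = -1 - ω) (hχ : χ α = ω) (hχ3 : χ ^ 3 = 1)
    {η : F → ℂ} {E : ZMod 3 → ℂ} (hη : ∀ x, x ≠ 0 → η x = E (cl x)) {R T A B : ℂ}
    (hR : R = Fintype.card F) (hT : T = -(jacobiSum χ χ + jacobiSum (χ ^ 2) (χ ^ 2)))
    (hA : A = -(ω ^ 2 * jacobiSum χ χ + ω * jacobiSum (χ ^ 2) (χ ^ 2)))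
    (hB : B = -(ω * jacobiSum χ χ + ω ^ 2 * jacobiSum (χ ^ 2) (χ ^ 2))) (G : ℂ → ℂ) :
    ∑ x : F, ∑ y : F, G (η x + η y + η (x + y)) =
      (R - 1) * (R - 8 - T) / 27 * (G (3 * E 0) + G (3 * E 1) + G (3 * E 2)) +
      (R - 1) * (R - 2 - A) / 9 *
        (G (2 * E 0 + E 1) + G (2 * E 1 + E 2) + G (2 * E 2 + E 0)) +
      (R - 1) * (R - 2 - B) / 9 *
        (G (2 * E 0 + E 2) + G (2 * E 1 + E 0) + G (2 * E 2 + E 1)) +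
      2 * (R - 1) * (R + 1 - T) / 9 * G (E 0 + E 1 + E 2) +
      (R - 1) * (G (η 0 + 2 * E 0) + G (η 0 + 2 * E 1) + G (η 0 + 2 * E 2)) +
      G (3 * η 0) := by
  have hv0 : (0 : ZMod 3).val = 0 := rfl
  have hv1 : (1 : ZMod 3).val = 1 := rfl
  have hv2 : (2 : ZMod 3).val = 2 := rfl
  have hn := hcl.cubicCyclotomicNumber_eq hα hω hχ hχ3
  rw [← hR] at hn
  set J := jacobiSum χ χ
  set J' := jacobiSum (χ ^ 2) (χ ^ 2)
  have n00 : cubicCyclotomicNumber cl 0 0 = (R - 8 - T) / 9 := by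
    rw [hn, hT, hv0]; ring
  have n01 : cubicCyclotomicNumber cl 0 1 = (R - 2 - A) / 9 := by
    rw [hn, hA, hv0, hv1]
    linear_combination (-2 / 9) * hω
  have n10 : cubicCyclotomicNumber cl 1 0 = (R - 2 - A) / 9 := by
    rw [hn, hA, hv0, hv1]
    linear_combination (-2 / 9) * hω
  have n22 : cubicCyclotomicNumber cl 2 2 = (R - 2 - A) / 9 := by
    rw [hn, hA, hv2]
    linear_combination ((-J' * ω - 2 * ω ^ 2 - J * ω ^ 2 + J' * ω ^ 2 + 2 * ω ^ 3 + J * ω ^ 3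
      - 2 * ω ^ 4 - J * ω ^ 5 + J * ω ^ 6) / 9) * hω
  have n02 : cubicCyclotomicNumber cl 0 2 = (R - 2 - B) / 9 := by
    rw [hn, hB, hv0, hv2]
    linear_combination ((-2 + 2 * ω - J * ω - 2 * ω ^ 2 + J * ω ^ 2) / 9) * hω
  have n20 : cubicCyclotomicNumber cl 2 0 = (R - 2 - B) / 9 := by
    rw [hn, hB, hv0, hv2]
    linear_combination ((-2 + 2 * ω - J * ω - 2 * ω ^ 2 + J * ω ^ 2) / 9) * hω
  have n11 : cubicCyclotomicNumber cl 1 1 = (R - 2 - B) / 9 := by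
    rw [hn, hB, hv1]
    linear_combination ((-2 * ω - J * ω + J * ω ^ 2) / 9) * hω
  have n12 : cubicCyclotomicNumber cl 1 2 = (R + 1 - T) / 9 := by
    rw [hn, hT, hv1, hv2]
    linear_combination ((-3 - J - J' + 2 * ω + J * ω + J' * ω
      - ω ^ 2 - ω ^ 3 - J * ω ^ 3 + J * ω ^ 4) / 9) * hω
  have n21 : cubicCyclotomicNumber cl 2 1 = (R + 1 - T) / 9 := by
    rw [hn, hT, hv1, hv2]
    linear_combination ((-3 - J - J' + 2 * ω + J * ω + J' * ω
      - ω ^ 2 - ω ^ 3 - J * ω ^ 3 + J * ω ^ 4) / 9) * hω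
  have e11 : (1 + 1 : ZMod 3) = 2 := rfl
  have e12 : (1 + 2 : ZMod 3) = 0 := rfl
  have e21 : (2 + 1 : ZMod 3) = 0 := rfl
  have e22 : (2 + 2 : ZMod 3) = 1 := rfl
  rw [hcl.sum_sum_comp hα hω hχ hη G, ← hR]
  simp only [ZMod.sum_univ_three, add_zero, zero_add, e11, e12, e21, e22, n00, n01, n10, n22, n02,
    n20, n11, n12, n21]
  ring_nf

/-- Weight distribution of `C_{(q,m,h,3)}` for `e = N = 3`,
`p ≡ 1 (mod 3)`, `3 ∣ m` and `3 ∣ (q−1)/h` (Table 3). -/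
theorem stmt_2 (p s m h : ℕ) (hp : p.Prime) (hp3 : p % 3 = 1) (hs : 1 ≤ s) (hm : 1 ≤ m)
    (hm3 : 3 ∣ m)
    (q r : ℕ) (hq : q = p ^ s) (hr : r = q ^ m)
    (hh : 0 < h) (hhq : h ∣ q - 1)
    (he : 3 ∣ Nat.gcd (q - 1) (h * m))
    (hN : Nat.gcd ((r - 1) / (q - 1)) (3 * (q - 1) / h) = 3)
    (hdvd : 3 ∣ (q - 1) / h)
    (K F : Type) [Field K] [Field F] [Algebra K F] [Fintype K] [Fintype F]
    [Algebra (ZMod p) F]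
    (hcardK : Fintype.card K = q) (hcardF : Fintype.card F = r)
    (α : Fˣ) (hα : ∀ x : Fˣ, x ∈ Subgroup.zpowers α)
    (g β : F) (hg : g = (α : F) ^ ((q - 1) / h)) (hβ : β = (α : F) ^ ((r - 1) / 3))
    (n : ℕ) (hn : n = h * (r - 1) / (q - 1))
    (lam : F → F → ℂ)
    (hlam : ∀ a b : F, lam a b = (h : ℂ) * ((r : ℂ) - 1) / q -
      (Set.ncard {i : Fin n |
        Algebra.trace K F (a * g ^ (i : ℕ) + b * (β * g) ^ (i : ℕ)) ≠ 0} : ℂ))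
    (ψ : F → ℂ)
    (hψ : ∀ x : F, ψ x = Complex.exp (2 * Real.pi * Complex.I *
      (ZMod.val (Algebra.trace (ZMod p) F x)) / p))
    (η : F → ℂ)
    (hη : ∀ u : F, η u =
      ∑ z ∈ Finset.univ.filter (fun x : F => x ≠ 0 ∧ ∃ y : F, y ^ 3 = x), ψ (z * u))
    (η₁ ηa ηa2 : ℂ) (hη₁ : η₁ = η 1) (hηa : ηa = η (α : F)) (hηa2 : ηa2 = η ((α : F) ^ 2))
    (a₀ b₀ : ℤ) (hpab : (p : ℤ) = a₀ ^ 2 - a₀ * b₀ + b₀ ^ 2)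
    (ha₀ : a₀ % 3 = 2) (hb₀ : b₀ % 3 = 0) (hb₀pos : 0 < b₀)
    (ω πc : ℂ) (hω : ω = (-1 + Complex.I * Real.sqrt 3) / 2)
    (hπ : πc = (a₀ : ℂ) + (b₀ : ℂ) * ω)
    (b' : ℤ) (hb' : (b₀ * b') % p = 1)
    (uα : ℂ)
    (huα₁ : ((α : F) ^ ((r - 1) / (p - 1))) ^ ((p - 1) / 3) =
      algebraMap (ZMod p) F ((-(b' * a₀) : ℤ) : ZMod p) → uα = ω)
    (huα₂ : ((α : F) ^ ((r - 1) / (p - 1))) ^ ((p - 1) / 3) =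
      algebraMap (ZMod p) F ((-1 + b' * a₀ : ℤ) : ZMod p) → uα = ω ^ 2)
    (T A B : ℂ)
    (hT : T = (-1 : ℂ) ^ (m * s) * (πc ^ (m * s) + (starRingEnd ℂ πc) ^ (m * s)))
    (hA : A = (-1 : ℂ) ^ (m * s) *
      (uα ^ 2 * πc ^ (m * s) + uα * (starRingEnd ℂ πc) ^ (m * s)))
    (hB : B = (-1 : ℂ) ^ (m * s) *
      (uα * πc ^ (m * s) + uα ^ 2 * (starRingEnd ℂ πc) ^ (m * s))) :
    (∀ a b : F,
      lam a b = 3 * (h : ℂ) / q * η₁ ∨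
      lam a b = 3 * (h : ℂ) / q * ηa ∨
      lam a b = 3 * (h : ℂ) / q * ηa2 ∨
      lam a b = (h : ℂ) / q * (2 * η₁ + ηa) ∨
      lam a b = (h : ℂ) / q * (2 * η₁ + ηa2) ∨
      lam a b = (h : ℂ) / q * (2 * ηa + η₁) ∨
      lam a b = (h : ℂ) / q * (2 * ηa + ηa2) ∨
      lam a b = (h : ℂ) / q * (2 * ηa2 + η₁) ∨
      lam a b = (h : ℂ) / q * (2 * ηa2 + ηa) ∨
      lam a b = -(h : ℂ) / q ∨
      lam a b = (h : ℂ) / (3 * q) * ((r : ℂ) - 1 + 6 * η₁) ∨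
      lam a b = (h : ℂ) / (3 * q) * ((r : ℂ) - 1 + 6 * ηa) ∨
      lam a b = (h : ℂ) / (3 * q) * ((r : ℂ) - 1 + 6 * ηa2) ∨
      lam a b = (h : ℂ) * ((r : ℂ) - 1) / q) ∧
    (∀ x : ℂ, (Set.ncard {ab : F × F | lam ab.1 ab.2 = x} : ℂ) =
      (if 3 * (h : ℂ) / q * η₁ = x then ((r : ℂ) - 1) * ((r : ℂ) - 8 - T) / 27 else 0) +
      (if 3 * (h : ℂ) / q * ηa = x then ((r : ℂ) - 1) * ((r : ℂ) - 8 - T) / 27 else 0) +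
      (if 3 * (h : ℂ) / q * ηa2 = x then ((r : ℂ) - 1) * ((r : ℂ) - 8 - T) / 27 else 0) +
      (if (h : ℂ) / q * (2 * η₁ + ηa) = x then
        ((r : ℂ) - 1) * ((r : ℂ) - 2 - A) / 9 else 0) +
      (if (h : ℂ) / q * (2 * η₁ + ηa2) = x then
        ((r : ℂ) - 1) * ((r : ℂ) - 2 - B) / 9 else 0) +
      (if (h : ℂ) / q * (2 * ηa + η₁) = x then
        ((r : ℂ) - 1) * ((r : ℂ) - 2 - B) / 9 else 0) +
      (if (h : ℂ) / q * (2 * ηa + ηa2) = x then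
        ((r : ℂ) - 1) * ((r : ℂ) - 2 - A) / 9 else 0) +
      (if (h : ℂ) / q * (2 * ηa2 + η₁) = x then
        ((r : ℂ) - 1) * ((r : ℂ) - 2 - A) / 9 else 0) +
      (if (h : ℂ) / q * (2 * ηa2 + ηa) = x then
        ((r : ℂ) - 1) * ((r : ℂ) - 2 - B) / 9 else 0) +
      (if -(h : ℂ) / q = x then 2 * ((r : ℂ) - 1) * ((r : ℂ) + 1 - T) / 9 else 0) +
      (if (h : ℂ) / (3 * q) * ((r : ℂ) - 1 + 6 * η₁) = x then (r : ℂ) - 1 else 0) +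
      (if (h : ℂ) / (3 * q) * ((r : ℂ) - 1 + 6 * ηa) = x then (r : ℂ) - 1 else 0) +
      (if (h : ℂ) / (3 * q) * ((r : ℂ) - 1 + 6 * ηa2) = x then (r : ℂ) - 1 else 0) +
      (if (h : ℂ) * ((r : ℂ) - 1) / q = x then 1 else 0)) := by
  subst hq hr hn hg hβ hη₁ hηa hηa2
  have : Fact p.Prime := ⟨hp⟩
  have : CharP F p := charP_of_injective_algebraMap (algebraMap (ZMod p) F).injective p
  set q := p ^ s with hq
  set r := q ^ m with hr
  have hq1 : 1 < q := Nat.one_lt_pow (by omega) hp.one_lt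
  have hr1 : 1 < r := Nat.one_lt_pow (by omega) hq1
  obtain ⟨d, hd⟩ := hhq
  have hqd : (q - 1) / h = d := by rw [hd, Nat.mul_div_cancel_left _ hh]
  have h3qd : 3 * (q - 1) / h = 3 * d := by
    rw [hd, mul_left_comm, Nat.mul_div_cancel_left _ hh]
  rw [hqd] at hdvd hlam
  obtain ⟨M, hM⟩ : q - 1 ∣ r - 1 := by simpa using Nat.sub_dvd_pow_sub_pow q 1 m
  have hMdiv : (r - 1) / (q - 1) = M := by rw [hM, Nat.mul_div_cancel_left _ (by omega)]
  rw [hMdiv, h3qd] at hN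
  obtain ⟨t, rfl⟩ : 3 ∣ M := hN ▸ Nat.gcd_dvd_left _ _
  have hnt : h * (r - 1) / (q - 1) = 3 * (h * t) := by
    rw [hM, mul_left_comm, Nat.mul_div_cancel_left _ (by omega)]
    ring
  have hrk : r = 3 * (t * (q - 1)) + 1 := by
    have : 3 * (t * (q - 1)) = (q - 1) * (3 * t) := by ring
    omega
  obtain ⟨k, hk⟩ : ∃ k, k = t * (q - 1) := ⟨_, rfl⟩
  rw [← hk] at hrk
  have hk3 : (r - 1) / 3 = k := by omega
  rw [hk3] at hlam
  obtain ⟨c, hc⟩ : 3 ∣ k := hk ▸ ((he.trans (Nat.gcd_dvd_left _ _)).mul_left t)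
  obtain ⟨cl, hcl⟩ := exists_isCubicIndex hα (by rw [hcardF, hrk]; simp)
  set β : F := (α : F) ^ k with hβ
  have hβ3 : β ^ 3 = 1 := by
    rw [hβ, ← pow_mul, pow_eq_one_iff_dvd hα, hcardF, hrk]
    exact dvd_of_eq (by simp [mul_comm])
  have hβ1 : β ≠ 1 := by
    rw [hβ, Ne, pow_eq_one_iff_dvd hα, hcardF]
    intro h
    have := Nat.le_of_dvd (by omega) h
    omega
  have hβ2 : β ^ 2 + β + 1 = 0 := by
    refine (mul_eq_zero.mp ?_).resolve_left (sub_ne_zero.mpr hβ1)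
    linear_combination hβ3
  have hsqrt : ((Real.sqrt 3 : ℝ) : ℂ) ^ 2 = 3 := by
    rw [← Complex.ofReal_pow, Real.sq_sqrt (by norm_num)]; norm_num
  have hω2 : ω ^ 2 = -1 - ω := by
    rw [hω]
    linear_combination (1 / 4 : ℂ) * (Complex.I ^ 2 * hsqrt) + (3 / 4 : ℂ) * Complex.I_sq
  have hconj : starRingEnd ℂ πc = a₀ + b₀ * ω ^ 2 := by
    rw [hω2, hπ, hω]
    simp only [map_add, map_mul, map_div₀, map_neg, map_one, map_ofNat, map_intCast,
      Complex.conj_I, Complex.conj_ofReal]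
    ring
  obtain ⟨χ, hχ, hχ3, hJ⟩ := EisensteinInt.exists_mulChar_complex (F := F) (l := m * s) (k := k)
    hp3 (by rw [hcardF, hr, hq, ← pow_mul, mul_comm]) (by rw [← hrk, hr, hq, ← pow_mul, mul_comm])
    hα hω2 hpab ha₀ hb₀ (by linear_combination hβ2)
  rw [← hβ, ← hπ, ← hconj] at hJ
  have hbb : (b₀ : F) * b' = 1 := by
    have : ((b₀ * b' : ℤ) : F) = ((1 : ℤ) : F) := by
      rw [CharP.intCast_eq_intCast F p, Int.ModEq, hb', Int.emod_eq_of_lt] <;>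
      linarith [show (1 : ℤ) < p by exact_mod_cast hp.one_lt]
    push_cast at this
    exact this
  have hαβ : ((α : F) ^ ((r - 1) / (p - 1))) ^ ((p - 1) / 3) = β := by
    have hpr : p - 1 ∣ r - 1 := by
      simpa [hr, hq, ← pow_mul] using Nat.sub_dvd_pow_sub_pow p 1 (s * m)
    have h3p : 3 ∣ p - 1 := by omega
    rw [← pow_mul, hβ, Nat.div_mul_div_comm hpr h3p, ← hk3, mul_comm (r - 1),
      Nat.mul_div_mul_left _ _ (by have := hp.one_lt; omega)]
  rw [hαβ, map_intCast] at huα₁ huα₂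
  push_cast at huα₁ huα₂
  have hω3 : ω ^ 3 = 1 := by linear_combination (ω - 1) * hω2
  have hTJ : T = -(jacobiSum χ χ + jacobiSum (χ ^ 2) (χ ^ 2)) := by
    rcases hJ with ⟨-, h1, h2⟩ | ⟨-, h1, h2⟩ <;> rw [hT, h1, h2] <;> ring
  have hABJ : A = -(ω ^ 2 * jacobiSum χ χ + ω * jacobiSum (χ ^ 2) (χ ^ 2)) ∧
      B = -(ω * jacobiSum χ χ + ω ^ 2 * jacobiSum (χ ^ 2) (χ ^ 2)) := by
    rcases hJ with ⟨h0, h1, h2⟩ | ⟨h0, h1, h2⟩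
    · have hu := huα₁ (by linear_combination (b' : F) * h0 - β * hbb)
      rw [hA, hB, h1, h2, hu]
      constructor <;> ring
    · have hu := huα₂ (by linear_combination (-b' : F) * h0 + β ^ 2 * hbb + hβ2)
      have hu2 : uα ^ 2 = ω := by rw [hu]; linear_combination ω * hω3
      rw [hA, hB, h1, h2, hu2, hu]
      constructor <;> ring
  have hψt : ψ = traceChar p F := by
    funext x
    rw [hψ, traceChar]
    conv_rhs => rw [← ZMod.natCast_zmod_val (Algebra.trace (ZMod p) F x), ← Int.cast_natCast,
      ZMod.stdAddChar_coe]
    push_cast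
    rfl
  have hηp : η = cubicPeriod (traceChar p F) := by
    funext u
    rw [hη, hψt]
    rfl
  have hη0 : η 0 = ((r : ℂ) - 1) / 3 := by
    rw [hηp, ← hcardF, ← hcl.card_cubes hα hω2 hχ, cubicPeriod]
    simp [traceChar_zero]
  set E : ZMod 3 → ℂ := fun i => η ((α : F) ^ i.val) with hE
  have hηE : ∀ x, x ≠ 0 → η x = E (cl x) := fun x hx => by
    rw [hE, hηp]; exact hcl.cubicPeriod_eq hα _ hx
  have hE0 : E 0 = η 1 := by simp [hE]
  have hE1 : E 1 = η α := congrArg η (pow_one _)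
  have hE2 : E 2 = η ((α : F) ^ 2) := rfl
  have hEsum : E 0 + E 1 + E 2 = -1 := by
    rw [← ZMod.sum_univ_three, hE, hηp, hcl.cubicPeriod_sum hα, sum_traceChar, traceChar_zero,
      zero_sub]
  have hlamη : ∀ a b, lam a b = (h : ℂ) / q * (η (a + b) + η (a + b * β) + η (a + b * β ^ 2)) := by
    intro a b
    have hmw := modifiedWeight_eq (K := K) (p := p) hcl hα hω2 hχ (hd.symm.trans (by rw [hcardK]))
      (by rw [hcardF, hcardK, hM]; ring) hN hdvd hβ3 a b
    rw [hlam, hηp, ← hcardK, ← hmw, hcardF, hcardK, hnt]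
  have hcount : ∀ x : ℂ, (Set.ncard {ab : F × F | lam ab.1 ab.2 = x} : ℂ) =
      ∑ y, ∑ z, if (h : ℂ) / q * (η y + η z + η (y + z)) = x then 1 else 0 := by
    intro x
    rw [← sum_prod_comp_of_cube hβ2 hβ1 (fun y => ?_) (fun y => ?_)
      (fun v => if (h : ℂ) / q * v = x then 1 else 0), Finset.sum_boole,
      Set.ncard_eq_toFinset_card']
    · simp only [Set.toFinset_ofPred, hlamη]
    · rw [hηp, hβ, hc, mul_comm 3 c, pow_mul, cubicPeriod_cube_mul _ (pow_ne_zero _ α.ne_zero)]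
    · rw [hηp, ← cubicPeriod_cube_mul _ (neg_ne_zero.mpr one_ne_zero) y]
      ring_nf
  have hmain : ∀ x : ℂ, (Set.ncard {ab : F × F | lam ab.1 ab.2 = x} : ℂ) = _ := fun x =>
    (hcount x).trans (hcl.sum_sum_comp_explicit hα hω2 hχ hχ3 hηE (R := r) (by rw [hcardF]) hTJ
      hABJ.1 hABJ.2 (fun v => if (h : ℂ) / q * v = x then 1 else 0))
  rw [hEsum, hE0, hE1, hE2, hη0] at hmain
  refine (and_iff_right_of_imp fun key a b => ?_).mpr fun x => ?_
  · by_contra hne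
    simp only [not_or] at hne
    obtain ⟨h1, h2, h3, h4, h5, h6, h7, h8, h9, h10, h11, h12, h13, h14⟩ := hne
    have h0 := key (lam a b)
    rw [if_neg (Ne.symm h1), if_neg (Ne.symm h2), if_neg (Ne.symm h3), if_neg (Ne.symm h4),
      if_neg (Ne.symm h5), if_neg (Ne.symm h6), if_neg (Ne.symm h7), if_neg (Ne.symm h8),
      if_neg (Ne.symm h9), if_neg (Ne.symm h10), if_neg (Ne.symm h11), if_neg (Ne.symm h12),
      if_neg (Ne.symm h13), if_neg (Ne.symm h14)] at h0
    have h00 : Set.ncard {ab : F × F | lam ab.1 ab.2 = lam a b} = 0 := by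
      simpa only [add_zero, Nat.cast_eq_zero] using h0
    rw [Set.ncard_eq_zero (Set.toFinite _)] at h00
    exact Set.notMem_empty (a, b) (h00 ▸ (rfl : lam a b = lam a b))
  · have e3 : ∀ v : ℂ, (h : ℂ) / q * (3 * v) = 3 * h / q * v := fun v => by ring
    have e6 : ∀ v : ℂ, (h : ℂ) / q * (((r : ℂ) - 1) / 3 + 2 * v) =
        h / (3 * q) * ((r : ℂ) - 1 + 6 * v) := fun v => by
      field_simp
      ring
    have e1 : (h : ℂ) / q * -1 = -h / q := by ring
    have e0 : (h : ℂ) / q * (3 * (((r : ℂ) - 1) / 3)) = h * ((r : ℂ) - 1) / q := by ring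
    rw [hmain x, e0, e1]
    simp only [e3, e6, mul_add, mul_boole]
    ring
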